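/- Let f : ℝ^{3×3} → ℝ^{3×3×3×3} be an arbitrary function (the prediction network producing a fourth-order tensor from the canonical lattice). Let L ∈ ℝ^{3×3} be invertible and let Q' ∈ ℝ^{3×3} be orthogonal. If L = Q₀H₀ and Q'L = Q₁H₁ are polar decompositions (Q₀, Q₁ orthogonal; H₀, H₁ positive semidefinite), then ρ₄(Q₁) f(H₁) = ρ₄(Q') (ρ₄(Q₀) f(H₀)). That is, the canonicalized elastic-tensor predictor h(L) = ρ₄(Q₀) f(H₀) is O(3)-equivariant: h(Q'L) = ρ₄(Q') h(L). -/

import Mathlib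

open Matrix

/-- The action of a `3 × 3` matrix on a fourth-order tensor:
`(ρ₄(Q)C)_{ijkl} = Σ_{m,n,p,q} Q_{im} Q_{jn} Q_{kp} Q_{lq} C_{mnpq}`. -/
def rho4 (Q : Matrix (Fin 3) (Fin 3) ℝ) (C : Fin 3 → Fin 3 → Fin 3 → Fin 3 → ℝ) :
    Fin 3 → Fin 3 → Fin 3 → Fin 3 → ℝ :=
  fun i j k l => ∑ m, ∑ n, ∑ p, ∑ q, Q i m * Q j n * Q k p * Q l q * C m n p q

open scoped MatrixOrder Matrix.Norms.L2Operator in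
theorem psd_sq_inj (A B : Matrix (Fin 3) (Fin 3) ℝ) (hA : A.PosSemidef) (hB : B.PosSemidef)
    (h : A * A = B * B) : A = B := by
  have hA' : 0 ≤ A := hA.nonneg
  have hB' : 0 ≤ B := hB.nonneg
  rw [← CFC.sqrt_unique h hA', CFC.sqrt_mul_self B hB']

theorem rho4_mul (A B : Matrix (Fin 3) (Fin 3) ℝ) (C : Fin 3 → Fin 3 → Fin 3 → Fin 3 → ℝ) :
    rho4 (A * B) C = rho4 A (rho4 B C) := by
  have key : ∀ (Q : Matrix (Fin 3) (Fin 3) ℝ) (C : Fin 3 → Fin 3 → Fin 3 → Fin 3 → ℝ) i j k l,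
      rho4 Q C i j k l = ∑ x : Fin 3 × Fin 3 × Fin 3 × Fin 3,
        Q i x.1 * Q j x.2.1 * Q k x.2.2.1 * Q l x.2.2.2 * C x.1 x.2.1 x.2.2.1 x.2.2.2 := by
    intro Q C i j k l
    simp only [rho4, Fintype.sum_prod_type]
  funext i j k l
  rw [key, key]
  simp only [key, Finset.mul_sum]
  rw [Finset.sum_comm]
  refine Finset.sum_congr rfl fun x _ => ?_
  have : (A * B) i x.1 * (A * B) j x.2.1 * (A * B) k x.2.2.1 * (A * B) l x.2.2.2 =
      ∑ y : Fin 3 × Fin 3 × Fin 3 × Fin 3, (A i y.1 * B y.1 x.1) * ((A j y.2.1 * B y.2.1 x.2.1) *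
        ((A k y.2.2.1 * B y.2.2.1 x.2.2.1) * (A l y.2.2.2 * B y.2.2.2 x.2.2.2))) := by
    simp only [Fintype.sum_prod_type, ← Finset.mul_sum, ← Finset.sum_mul, Matrix.mul_apply]
    ring
  rw [this, Finset.sum_mul]
  exact Finset.sum_congr rfl fun y _ => by ring

/-- The canonicalized elastic-tensor predictor `h(L) = ρ₄(Q₀) f(H₀)` (with `L = Q₀H₀`
the polar decomposition) is `O(3)`-equivariant: `h(Q'L) = ρ₄(Q') h(L)`. -/
theorem canonicalized_elastic_predictor_equivariant
    (f : Matrix (Fin 3) (Fin 3) ℝ → (Fin 3 → Fin 3 → Fin 3 → Fin 3 → ℝ))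
    (L Q' Q₀ H₀ Q₁ H₁ : Matrix (Fin 3) (Fin 3) ℝ)
    (hL : IsUnit L)
    (hQ' : Q'ᵀ * Q' = 1)
    (hQ₀ : Q₀ᵀ * Q₀ = 1) (hH₀ : H₀.PosSemidef) (hL₀ : L = Q₀ * H₀)
    (hQ₁ : Q₁ᵀ * Q₁ = 1) (hH₁ : H₁.PosSemidef) (hL₁ : Q' * L = Q₁ * H₁) :
    rho4 Q₁ (f H₁) = rho4 Q' (rho4 Q₀ (f H₀)) := by
  have hs : H₁ = H₀ := by
    apply psd_sq_inj _ _ hH₁ hH₀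
    have e1 : H₁ᵀ = H₁ := by simpa using hH₁.isHermitian.eq
    have e0 : H₀ᵀ = H₀ := by simpa using hH₀.isHermitian.eq
    have a1 : (Q' * L)ᵀ * (Q' * L) = H₁ * H₁ := by
      rw [hL₁, transpose_mul, e1, Matrix.mul_assoc, ← Matrix.mul_assoc Q₁ᵀ, hQ₁, Matrix.one_mul]
    have a2 : (Q' * L)ᵀ * (Q' * L) = Lᵀ * L := by
      rw [transpose_mul, Matrix.mul_assoc, ← Matrix.mul_assoc Q'ᵀ, hQ', Matrix.one_mul]
    have a3 : Lᵀ * L = H₀ * H₀ := by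
      rw [hL₀, transpose_mul, e0, Matrix.mul_assoc, ← Matrix.mul_assoc Q₀ᵀ, hQ₀, Matrix.one_mul]
    rw [← a1, a2, a3]
  subst hs
  have hu : IsUnit H₁ := by
    have : H₁ = Q₀ᵀ * L := by rw [hL₀, ← Matrix.mul_assoc, hQ₀, Matrix.one_mul]
    rw [this]
    exact (IsUnit.of_mul_eq_one _ hQ₀).mul hL
  have hq : Q₁ = Q' * Q₀ := by
    apply hu.mul_right_cancel
    rw [← hL₁, hL₀, Matrix.mul_assoc]
  rw [hq, rho4_mul]
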